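/- arXiv:2503.01985 — 6 statements merged into one kernel-verified Lean document; each statement's English description precedes it below -/
import Mathlib

section
/- Let E=(C,V,k,B) be an election with n voters and m candidates, and let S ⊊ V be a nonempty group of voters. Then either for every subset W ⊆ C with |W| = k and every voter i ∈ S it holds |A_i ∩ W| + |D_i ∩ (C ∖ W)| ≥ claim(S), or claim(S) ≤ (|S|/n)·(|D_S| + min(k, |A_S|)). -/
open Finset

variable {C V : Type*}

/-- The set of (virtual) positive copies of a set of candidates. -/
def posOf [DecidableEq C] (X : Finset C) : Finset (C ⊕ C) := X.image Sum.inl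

/-- The set of virtual negative counterparts `¬c` of a set of candidates. -/
def negOf [DecidableEq C] (X : Finset C) : Finset (C ⊕ C) := X.image Sum.inr

/-- The positive part `W ∩ C` of an outcome `W ⊆ C ∪ ¬C`. -/
def posPart [Fintype C] [DecidableEq C] (W : Finset (C ⊕ C)) : Finset C :=
  univ.filter (fun c => Sum.inl c ∈ W)

/-- Feasibility: at most `k` positive candidates, and never both `c` and `¬c`. -/
def Feasible [Fintype C] [DecidableEq C] (k : ℕ) (W : Finset (C ⊕ C)) : Prop :=
  (posPart W).card ≤ k ∧ ∀ c : C, ¬ (Sum.inl c ∈ W ∧ Sum.inr c ∈ W)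

/-- Common intersection `⋂_{i ∈ S} F i` (e.g. `A_S` or `D_S`). -/
def comInt [Fintype C] [DecidableEq C] (F : V → Finset C) (S : Finset V) : Finset C :=
  univ.filter (fun c => ∀ i ∈ S, c ∈ F i)

/-- Utility of voter `i` in the symmetric model: `|A_i ∩ W| + |¬D_i ∩ W|`. -/
def util [DecidableEq C] (A D : V → Finset C) (i : V) (W : Finset (C ⊕ C)) : ℕ :=
  ((posOf (A i) ∪ negOf (D i)) ∩ W).card

/-- `ℓ`-cohesiveness of a group `S` in the symmetric model. -/
def Cohesive [Fintype C] [DecidableEq C] [Fintype V] (A D : V → Finset C)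
    (k ℓ : ℕ) (S : Finset V) : Prop :=
  ∀ T : Finset (C ⊕ C), Feasible k T →
    (∃ X ⊆ posOf (comInt A S) ∪ negOf (comInt D S), ℓ ≤ X.card ∧ Feasible k (T ∪ X)) ∨
    (ℓ : ℚ) / ((T.card : ℚ) + (ℓ : ℚ)) < (S.card : ℚ) / (Fintype.card V : ℚ)

/-- The closed formula `claim(S)`, given `n = |V|`, `m = |C|`, `k`, `s = |S|`,
`aS = |A_S|`, `dS = |D_S|`. -/
def claimQ (n m k s aS dS : ℕ) : ℚ :=
  if (n : ℚ) / ((n : ℚ) - (s : ℚ)) * k ≤ (dS : ℚ) then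
    (dS : ℚ) - (k : ℚ)
  else if ((n : ℚ) - (s : ℚ)) / n * k ≤ (dS : ℚ) ∧
      (dS : ℚ) ≤ (n : ℚ) / ((n : ℚ) - (s : ℚ)) * k ∧
      (k : ℚ) ≤ (2 * (n : ℚ) - (s : ℚ)) / n * aS + ((n : ℚ) - (s : ℚ)) / n * dS then
    (s : ℚ) / (2 * (n : ℚ) - (s : ℚ)) * ((dS : ℚ) + (k : ℚ))
  else if (k : ℚ) ≤ (aS : ℚ) + (dS : ℚ) ∧ (dS : ℚ) ≤ ((n : ℚ) - (s : ℚ)) / n * k ∧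
      (aS : ℚ) ≤ (m : ℚ) - ((n : ℚ) - (s : ℚ)) / n * k then
    (s : ℚ) / n * k
  else if (k : ℚ) ≤ (aS : ℚ) + (dS : ℚ) ∧ (dS : ℚ) ≤ ((n : ℚ) - (s : ℚ)) / n * k ∧
      (m : ℚ) - ((n : ℚ) - (s : ℚ)) / n * k ≤ (aS : ℚ) ∧
      (aS : ℚ) + (k : ℚ) - (m : ℚ) ≤ (s : ℚ) / n * ((aS : ℚ) + (dS : ℚ)) then
    (aS : ℚ) + (k : ℚ) - (m : ℚ)
  else
    (s : ℚ) / n * ((aS : ℚ) + (dS : ℚ))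

/-- Every value of `claimQ` is bounded by one of the two guaranteed satisfactions
`dS - k`, `aS + k - m`, or by the proportional share of `dS + min k aS`. -/
theorem claimQ_le_cases {n m k s aS dS : ℕ} (hs : 0 < s) (hsn : s < n) :
    claimQ n m k s aS dS ≤ (dS : ℚ) - k ∨ claimQ n m k s aS dS ≤ (aS : ℚ) + k - m ∨
      claimQ n m k s aS dS ≤ (s : ℚ) / n * ((dS : ℚ) + (min k aS : ℕ)) := by
  have hsQ : (0 : ℚ) < s := by exact_mod_cast hs
  have hsnQ : (s : ℚ) < n := by exact_mod_cast hsn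
  have hn : (0 : ℚ) < n := hsQ.trans hsnQ
  have hp : (0 : ℚ) < s / n := by positivity
  have hp1 : (s : ℚ) / n < 1 := (div_lt_one hn).2 hsnQ
  have hcompl : ((n : ℚ) - s) / n = 1 - (s : ℚ) / n := by field_simp
  have htwo : (2 * (n : ℚ) - s) / n = 2 - (s : ℚ) / n := by field_simp
  have hratio : (s : ℚ) / (2 * n - s) = (s : ℚ) / n / (2 - (s : ℚ) / n) := by
    rw [← htwo]
    field_simp
  unfold claimQ
  rw [hcompl, htwo, hratio]
  generalize (s : ℚ) / n = p at *
  have hmin : ((min k aS : ℕ) : ℚ) = min (k : ℚ) aS := Nat.cast_min k aS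
  rw [hmin]
  split_ifs with h₁ h₂ h₃ h₄
  · exact Or.inl le_rfl
  · right; right
    obtain ⟨-, -, h⟩ := h₂
    rw [div_mul_eq_mul_div, div_le_iff₀ (by linarith), mul_assoc]
    apply mul_le_mul_of_nonneg_left _ hp.le
    rcases min_cases (k : ℚ) aS with ⟨hm, -⟩ | ⟨hm, -⟩ <;> rw [hm] <;> nlinarith
  · right; right
    apply mul_le_mul_of_nonneg_left _ hp.le
    rcases min_cases (k : ℚ) aS with ⟨hm, -⟩ | ⟨hm, -⟩ <;> rw [hm] <;> linarith [h₃.1]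
  · exact Or.inr (Or.inl le_rfl)
  · right
    rcases le_total (aS : ℚ) k with hak | hka
    · right
      rw [min_eq_right hak, add_comm]
    · left
      have hdk : (dS : ℚ) ≤ (1 - p) * k := by
        by_contra! hlt
        exact h₂ ⟨hlt.le, (not_le.1 h₁).le, by nlinarith⟩
      have ham : (m : ℚ) - (1 - p) * k ≤ aS := by
        by_contra! hlt
        exact h₃ ⟨by linarith, hdk, hlt.le⟩
      by_contra! hlt
      exact h₄ ⟨by linarith, hdk, ham, hlt.le⟩

/-- A set of size `a` meets every `k`-subset in at least `a + k - m` elements. -/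
theorem card_add_card_le_card_inter_add [Fintype C] [DecidableEq C] (X W : Finset C) :
    X.card + W.card ≤ (X ∩ W).card + Fintype.card C := by
  have h := card_union_add_card_inter X W
  have h' := card_le_univ (X ∪ W)
  omega

/-- All members of a group contain the common intersection of the group. -/
theorem comInt_subset [Fintype C] [DecidableEq C] (F : V → Finset C) {S : Finset V} {i : V}
    (hi : i ∈ S) : comInt F S ⊆ F i :=
  fun _ hc => (mem_filter.1 hc).2 i hi

/-- For a nonempty proper group `S ⊊ V`, either every `k`-element
committee `W ⊆ C` gives each voter `i ∈ S` satisfaction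
`|A_i ∩ W| + |D_i ∩ (C ∖ W)| ≥ claim(S)`, or
`claim(S) ≤ (|S|/n) · (|D_S| + min(k, |A_S|))`. -/
theorem stmt_1 [Fintype C] [DecidableEq C] [Fintype V] [DecidableEq V]
    (k : ℕ) (A D : V → Finset C)
    (hdisj : ∀ i, Disjoint (A i) (D i)) (hk : 0 < k) (hkm : k ≤ Fintype.card C)
    (S : Finset V) (hS : S.Nonempty) (hSV : S ⊂ univ) :
    (∀ W : Finset C, W.card = k → ∀ i ∈ S,
      claimQ (Fintype.card V) (Fintype.card C) k S.card
          (comInt A S).card (comInt D S).card ≤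
        (((A i ∩ W).card + (D i \ W).card : ℕ) : ℚ)) ∨
    claimQ (Fintype.card V) (Fintype.card C) k S.card
        (comInt A S).card (comInt D S).card ≤
      (S.card : ℚ) / (Fintype.card V : ℚ) *
        (((comInt D S).card : ℚ) + (min k (comInt A S).card : ℕ)) := by
  have hsn : S.card < Fintype.card V := card_lt_card hSV
  rcases claimQ_le_cases (m := Fintype.card C) (k := k) (aS := (comInt A S).card)
    (dS := (comInt D S).card) hS.card_pos hsn with h | h | h
  · refine Or.inl fun W hW i hi => h.trans ?_
    have hsub := card_le_card (comInt_subset D hi)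
    have hdiff := le_card_sdiff W (D i)
    have hle : (comInt D S).card ≤ (A i ∩ W).card + (D i \ W).card + k := by omega
    rw [sub_le_iff_le_add]
    exact_mod_cast hle
  · refine Or.inl fun W hW i hi => h.trans ?_
    have hsub := card_le_card (comInt_subset A hi)
    have hinter := card_add_card_le_card_inter_add (A i) W
    have hle : (comInt A S).card + k ≤
        (A i ∩ W).card + (D i \ W).card + Fintype.card C := by omega
    rw [sub_le_iff_le_add]
    exact_mod_cast hle
  · exact Or.inr h
end

section
/- Let E=(C,V,k,B) be an election, let S ⊆ V be a nonempty group of voters, and let ℓ be a positive integer such that S is ℓ-cohesive. Then in any execution of Phragmén's rule for thumbs-up/down voting, the set of candidates selected by time ℓ/|S| contains at least ℓ elements of ⋃_{i∈S} (A_i ∪ ¬D_i). -/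
open Finset

variable {C V : Type*}

/-- Supporters of an item: approvers of `c` for a positive candidate `c`,
disapprovers of `c` for a negative counterpart `¬c`. -/
def supporters [Fintype V] [DecidableEq C] (A D : V → Finset C) : C ⊕ C → Finset V
  | Sum.inl c => univ.filter (fun i => c ∈ A i)
  | Sum.inr c => univ.filter (fun i => c ∈ D i)

/-- Availability of an item `x` just before the `j`-th purchase of a run with
purchase sequence `item`: neither `x` nor its counterpart has been bought yet,
and if `x` is a positive candidate then fewer than `k` positive candidates
have been bought so far. -/
def availAt [DecidableEq C] (k : ℕ) {num : ℕ} (item : Fin num → C ⊕ C)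
    (j : ℕ) (x : C ⊕ C) : Prop :=
  (∀ j' : Fin num, (j' : ℕ) < j → item j' ≠ x ∧ item j' ≠ x.swap) ∧
  (x.isLeft = true →
    (univ.filter (fun j' : Fin num => (j' : ℕ) < j ∧ (item j').isLeft = true)).card < k)

/-- An execution of Phragmén's rule for thumbs-up/down voting.  All voters earn
money continuously at unit rate; `item j` is the `j`-th bought item (a candidate
or a negative counterpart, each of cost 1), bought at time `time j`; `bud j i` is
the unspent budget of voter `i` just before the `j`-th purchase (the budgets of
all supporters of a bought item are reset to 0, i.e. spent in full).  Purchases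
happen as soon as the supporters of an available item jointly hold 1 unit of
money, and the run stops only when no available item can ever be bought. -/
structure PhragmenExec [Fintype C] [DecidableEq C] [Fintype V] [DecidableEq V]
    (A D : V → Finset C) (k : ℕ) where
  num : ℕ
  item : Fin num → C ⊕ C
  time : Fin num → ℝ
  bud : Fin num → V → ℝ
  time_nonneg : ∀ j, 0 ≤ time j
  time_mono : Monotone time
  bud_def : ∀ (j : Fin num) (i : V),
    bud j i = time j - ∑ j' ∈ univ.filter
      (fun j' : Fin num => j' < j ∧ i ∈ supporters A D (item j')), bud j' i
  item_avail : ∀ j : Fin num, availAt k item (j : ℕ) (item j)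
  pay : ∀ j : Fin num, ∑ i ∈ supporters A D (item j), bud j i = 1
  eager : ∀ (j : Fin num) (x : C ⊕ C), availAt k item (j : ℕ) x →
    ∑ i ∈ supporters A D x, bud j i ≤ 1
  exhaust : ∀ x : C ⊕ C, availAt k item num x → supporters A D x = ∅

theorem subset_supporters_of_mem_common [Fintype C] [DecidableEq C] [Fintype V]
    {A D : V → Finset C} {S : Finset V} {x : C ⊕ C}
    (hx : x ∈ posOf (comInt A S) ∪ negOf (comInt D S)) : S ⊆ supporters A D x := by
  intro i hi
  rcases x with c | c <;> simp [posOf, negOf, comInt, supporters] at hx ⊢ <;> exact hx i hi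

theorem mem_ballot_iff_mem_supporters [DecidableEq C] [Fintype V]
    {A D : V → Finset C} {i : V} {x : C ⊕ C} :
    x ∈ posOf (A i) ∪ negOf (D i) ↔ i ∈ supporters A D x := by
  rcases x with c | c <;> simp [posOf, negOf, supporters]

theorem notMem_supporters_swap [DecidableEq C] [Fintype V] {A D : V → Finset C}
    (hdisj : ∀ i, Disjoint (A i) (D i)) {i : V} {x : C ⊕ C} (hx : i ∈ supporters A D x) :
    i ∉ supporters A D x.swap := by
  have h := Finset.disjoint_left.1 (hdisj i)
  rcases x with c | c <;> simp [supporters] at hx ⊢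
  · exact h hx
  · exact fun h' => h h' hx

theorem card_posPart [Fintype C] [DecidableEq C] (W : Finset (C ⊕ C)) :
    (posPart W).card = (W.filter (fun x => x.isLeft = true)).card := by
  rw [← Finset.card_image_of_injective (posPart W) (Sum.inl_injective (β := C))]
  congr 1
  ext x
  rcases x with c | c <;> simp [_root_.posPart]

theorem feasible_iff [Fintype C] [DecidableEq C] {k : ℕ} {W : Finset (C ⊕ C)} :
    Feasible k W ↔ (W.filter (fun x => x.isLeft = true)).card ≤ k ∧
      ∀ x ∈ W, x.swap ∉ W := by
  rw [Feasible, card_posPart]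
  refine and_congr_right fun _ => ⟨fun h x hx hx' => ?_, fun h c hc => h _ hc.1 hc.2⟩
  rcases x with c | c
  · exact h c ⟨hx, hx'⟩
  · exact h c ⟨hx', hx⟩

theorem Feasible.mono [Fintype C] [DecidableEq C] {k : ℕ} {W W' : Finset (C ⊕ C)}
    (h : Feasible k W) (hsub : W' ⊆ W) : Feasible k W' := by
  rw [feasible_iff] at h ⊢
  exact ⟨(card_le_card (filter_subset_filter _ hsub)).trans h.1,
    fun x hx hx' => h.2 x (hsub hx) (hsub hx')⟩

/-- If `Y` only blocks counterparts outside `X` and is smaller than `X`, then some element of `X`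
can still be added to `T ∪ Y`. -/
theorem exists_extension_of_card_lt [Fintype C] [DecidableEq C] {k : ℕ}
    {T X Y : Finset (C ⊕ C)} (hTX : Feasible k (T ∪ X)) (hdisj : Disjoint T X)
    (hYX : ∀ x ∈ X, x.swap ∉ Y) (hcard : Y.card < X.card) :
    ∃ x ∈ X, x ∉ T ∪ Y ∧ x.swap ∉ T ∪ Y ∧
      (x.isLeft = true → ((T ∪ Y).filter (fun y => y.isLeft = true)).card < k) := by
  rw [feasible_iff] at hTX
  obtain ⟨hcap, hpair⟩ := hTX
  by_contra! hno
  have hswap : ∀ x ∈ X, x.swap ∉ T ∪ Y := fun x hx h => by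
    rcases mem_union.1 h with h | h
    · exact hpair x (mem_union_right _ hx) (mem_union_left _ h)
    · exact hYX x hx h
  have hfull : ∀ x ∈ X, x ∉ Y → x.isLeft = true ∧
      k ≤ ((T ∪ Y).filter (fun y => y.isLeft = true)).card := fun x hx hxY =>
    hno x hx (by simp [hxY, disjoint_right.1 hdisj hx]) (hswap x hx)
  obtain ⟨x, hxX, hxY⟩ := exists_mem_notMem_of_card_lt_card hcard
  have hk := (hfull x hxX hxY).2
  rw [filter_union] at hcap hk
  rw [card_union_of_disjoint (disjoint_filter_filter hdisj)] at hcap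
  have h1 := hk.trans (card_union_le _ _)
  have h2 : (X.filter (fun y => ¬ y.isLeft = true)).card ≤
      (Y.filter (fun y => ¬ y.isLeft = true)).card := by
    refine card_le_card fun y hy => ?_
    rw [mem_filter] at hy ⊢
    refine ⟨?_, hy.2⟩
    by_contra hyY
    exact hy.2 (hfull y hy.1 hyY).1
  have h3 := card_filter_add_card_filter_not (s := X) (fun y => y.isLeft = true)
  have h4 := card_filter_add_card_filter_not (s := Y) (fun y => y.isLeft = true)
  omega

namespace PhragmenExec

variable [Fintype C] [DecidableEq C] [Fintype V] [DecidableEq V]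
  {A D : V → Finset C} {k : ℕ}

/-- The money voter `i` spends on the first `N` purchases. -/
noncomputable def spent (E : PhragmenExec A D k) (N : ℕ) (i : V) : ℝ :=
  ∑ j ∈ univ.filter (fun j : Fin E.num => (j : ℕ) < N ∧ i ∈ supporters A D (E.item j)), E.bud j i

/-- The set of the first `N` bought items. -/
def bought (E : PhragmenExec A D k) (N : ℕ) : Finset (C ⊕ C) :=
  (univ.filter (fun j : Fin E.num => (j : ℕ) < N)).image E.item

theorem bud_eq (E : PhragmenExec A D k) (j : Fin E.num) (i : V) :
    E.bud j i = E.time j - E.spent j i := E.bud_def j i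

theorem spent_succ (E : PhragmenExec A D k) (j : Fin E.num) (i : V) :
    E.spent (j + 1) i =
      E.spent j i + if i ∈ supporters A D (E.item j) then E.bud j i else 0 := by
  have hj : ∑ j' : Fin E.num, (if j' = j then
      (if i ∈ supporters A D (E.item j) then E.bud j i else 0) else 0) =
      if i ∈ supporters A D (E.item j) then E.bud j i else 0 := by simp
  rw [← hj, spent, spent, sum_filter, sum_filter, ← sum_add_distrib]
  refine sum_congr rfl fun j' _ => ?_
  rcases lt_trichotomy j' j with h | rfl | h
  · have h1 : (j' : ℕ) < j := h
    simp [h.ne, h1, Nat.lt_succ_of_lt h1]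
  · simp
  · have h1 : (j : ℕ) < j' := h
    simp [h.ne', h1.not_gt, show ¬ (j' : ℕ) < j + 1 by omega]

theorem spent_le (E : PhragmenExec A D k) {t : ℝ} (ht : 0 ≤ t) (i : V) {N : ℕ} (hN : N ≤ E.num)
    (htime : ∀ j : Fin E.num, (j : ℕ) < N → E.time j ≤ t) : E.spent N i ≤ t := by
  induction N with
  | zero => simpa [spent] using ht
  | succ N ih =>
    have h1 := E.spent_succ ⟨N, hN⟩ i
    have h2 := ih (by omega) fun j hj => htime j (by omega)
    have h3 := E.bud_eq ⟨N, hN⟩ i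
    have h4 := htime ⟨N, hN⟩ (Nat.lt_succ_self N)
    dsimp only at h1 h3
    split_ifs at h1 <;> linarith

theorem bud_nonneg (E : PhragmenExec A D k) (j : Fin E.num) (i : V) : 0 ≤ E.bud j i := by
  rw [bud_eq, sub_nonneg]
  exact E.spent_le (E.time_nonneg j) i j.2.le fun j' h => E.time_mono h.le

theorem sum_spent (E : PhragmenExec A D k) (N : ℕ) (R : Finset V) :
    ∑ i ∈ R, E.spent N i = ∑ j ∈ univ.filter (fun j : Fin E.num => (j : ℕ) < N),
      ∑ i ∈ R ∩ supporters A D (E.item j), E.bud j i := by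
  simp only [spent, ← filter_filter]
  simp_rw [sum_filter (fun j => _ ∈ supporters A D (E.item j))]
  rw [sum_comm]
  refine sum_congr rfl fun j _ => ?_
  rw [← filter_mem_eq_inter, sum_filter]

theorem item_injective (E : PhragmenExec A D k) : Function.Injective E.item := by
  intro a b hab
  rcases lt_trichotomy a b with h | h | h
  · exact absurd hab ((E.item_avail b).1 a h).1
  · exact h
  · exact absurd hab.symm ((E.item_avail a).1 b h).1

theorem card_filter_bought (E : PhragmenExec A D k) (N : ℕ) (p : C ⊕ C → Prop)
    [DecidablePred p] : ((E.bought N).filter p).card =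
      (univ.filter (fun j : Fin E.num => (j : ℕ) < N ∧ p (E.item j))).card := by
  rw [bought, filter_image, card_image_of_injective _ E.item_injective, filter_filter]

theorem availAt_iff (E : PhragmenExec A D k) (N : ℕ) (x : C ⊕ C) :
    availAt k E.item N x ↔ x ∉ E.bought N ∧ x.swap ∉ E.bought N ∧
      (x.isLeft = true → ((E.bought N).filter (fun y => y.isLeft = true)).card < k) := by
  rw [card_filter_bought, availAt, ← and_assoc]
  refine and_congr_left fun _ => ?_
  simp only [bought, mem_image, mem_filter, mem_univ, true_and, not_exists, not_and]
  exact ⟨fun h => ⟨fun j hj => (h j hj).1, fun j hj => (h j hj).2⟩,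
    fun h j hj => ⟨h.1 j hj, h.2 j hj⟩⟩

theorem feasible_bought (E : PhragmenExec A D k) {N : ℕ} (hN : N ≤ E.num) :
    Feasible k (E.bought N) := by
  induction N with
  | zero => simp [feasible_iff, bought]
  | succ N ih =>
    have h := ih (by omega)
    have hav := (E.availAt_iff N _).1 (E.item_avail ⟨N, hN⟩)
    have hb : E.bought (N + 1) = insert (E.item ⟨N, hN⟩) (E.bought N) := by
      ext x
      simp only [bought, mem_image, mem_filter, mem_univ, true_and, mem_insert]
      constructor
      · rintro ⟨j, hj, rfl⟩
        rcases Nat.lt_succ_iff_lt_or_eq.1 hj with hj | hj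
        · exact Or.inr ⟨j, hj, rfl⟩
        · exact Or.inl (congrArg E.item (Fin.ext hj))
      · rintro (rfl | ⟨j, hj, rfl⟩)
        · exact ⟨_, Nat.lt_succ_self N, rfl⟩
        · exact ⟨j, by omega, rfl⟩
    generalize E.item ⟨N, hN⟩ = y at hav hb
    rw [feasible_iff] at h ⊢
    obtain ⟨hy, hys, hyk⟩ := hav
    rw [hb]
    constructor
    · rw [filter_insert]
      split_ifs with hl
      · exact (card_insert_le _ _).trans (hyk hl)
      · exact h.1
    · intro x hx hx'
      rcases mem_insert.1 hx with rfl | hx <;> rcases mem_insert.1 hx' with hx' | hx'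
      · rcases x with c | c <;> simp at hx'
      · exact hys hx'
      · rw [← hx', Sum.swap_swap] at hys
        exact hys hx
      · exact h.2 x hx hx'

theorem exists_purchase_count (E : PhragmenExec A D k) (t : ℝ) :
    ∃ N ≤ E.num, ∀ j : Fin E.num, E.time j ≤ t ↔ (j : ℕ) < N := by
  by_cases h : ∃ n, ∃ hn : n < E.num, t < E.time ⟨n, hn⟩
  · classical
    obtain ⟨hn, ht⟩ := Nat.find_spec h
    refine ⟨Nat.find h, hn.le, fun j => ⟨fun hj => ?_, fun hj => ?_⟩⟩
    · by_contra! hlt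
      exact absurd (E.time_mono (show (⟨_, hn⟩ : Fin E.num) ≤ j from hlt)) (by linarith)
    · by_contra! hlt
      exact Nat.find_min h hj ⟨j.2, hlt⟩
  · push Not at h
    exact ⟨E.num, le_rfl, fun j => ⟨fun _ => j.2, fun _ => h j j.2⟩⟩

/-- The purchases up to time `t` leave no item available that a group still holding one unit at
time `t` supports unanimously. -/
theorem not_availAt_of_one_le (E : PhragmenExec A D k) {t : ℝ} {N : ℕ} (hN : N ≤ E.num)
    (htime : ∀ j : Fin E.num, E.time j ≤ t ↔ (j : ℕ) < N) {S : Finset V} (hS : S.Nonempty)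
    (hrest : 1 ≤ ∑ i ∈ S, (t - E.spent N i)) {x : C ⊕ C} (hx : S ⊆ supporters A D x) :
    ¬ availAt k E.item N x := by
  intro hav
  rcases hN.eq_or_lt with rfl | hlt
  · obtain ⟨i, hi⟩ := hS
    simpa [E.exhaust x hav] using hx hi
  · have hgt : t < E.time ⟨N, hlt⟩ := by
      by_contra! h
      exact lt_irrefl N ((htime ⟨N, hlt⟩).1 h)
    have h1 := E.eager ⟨N, hlt⟩ x hav
    have h2 : ∑ i ∈ S, E.bud ⟨N, hlt⟩ i ≤ ∑ i ∈ supporters A D x, E.bud ⟨N, hlt⟩ i :=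
      sum_le_sum_of_subset_of_nonneg hx fun i _ _ => E.bud_nonneg _ i
    have h3 : ∑ i ∈ S, (t - E.spent N i) < ∑ i ∈ S, E.bud ⟨N, hlt⟩ i :=
      sum_lt_sum_of_nonempty hS fun i _ => by rw [bud_eq]; linarith
    linarith

/-- The members of `S` jointly spend at most one unit per bought item one of them supports. -/
theorem sum_spent_le_card (E : PhragmenExec A D k) (N : ℕ) (S : Finset V) (U : Finset (C ⊕ C))
    (hU : ∀ x, x ∈ U ↔ ∃ i ∈ S, i ∈ supporters A D x) :
    ∑ i ∈ S, E.spent N i ≤ (E.bought N ∩ U).card := by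
  rw [← filter_mem_eq_inter, card_filter_bought, sum_spent, ← filter_filter, card_filter]
  push_cast
  refine sum_le_sum fun j _ => ?_
  split_ifs with h
  · rw [← E.pay j]
    exact sum_le_sum_of_subset_of_nonneg inter_subset_right fun i _ _ => E.bud_nonneg j i
  · rw [hU] at h
    push Not at h
    rw [disjoint_iff_inter_eq_empty.1 (disjoint_left.2 h), sum_empty]

/-- The bought items without a supporter in `S` are paid for by the voters outside `S`. -/
theorem card_le_sum_spent_compl (E : PhragmenExec A D k) (N : ℕ) (S : Finset V)
    (U : Finset (C ⊕ C)) (hU : ∀ x, x ∈ U ↔ ∃ i ∈ S, i ∈ supporters A D x) :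
    ((E.bought N \ U).card : ℝ) ≤ ∑ i ∈ Sᶜ, E.spent N i := by
  rw [sdiff_eq_filter, card_filter_bought, sum_spent, ← filter_filter, card_filter]
  push_cast
  refine sum_le_sum fun j _ => ?_
  split_ifs with h
  · exact sum_nonneg fun i _ => E.bud_nonneg j i
  · rw [← E.pay j]
    refine (sum_le_sum_of_subset_of_nonneg (fun i hi => ?_) fun i _ _ => E.bud_nonneg j i)
    rw [mem_inter, mem_compl]
    exact ⟨fun hiS => h ((hU _).2 ⟨i, hiS, hi⟩), hi⟩

end PhragmenExec

/-- if a nonempty group `S` is `ℓ`-cohesive, then in any execution of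
Phragmén's rule for thumbs-up/down voting, the set of items selected by time
`ℓ/|S|` contains at least `ℓ` elements of `⋃_{i ∈ S} (A_i ∪ ¬D_i)`. -/
theorem stmt_2 [Fintype C] [DecidableEq C] [Fintype V] [DecidableEq V]
    (k : ℕ) (A D : V → Finset C)
    (hdisj : ∀ i, Disjoint (A i) (D i)) (hk : 0 < k) (hkm : k ≤ Fintype.card C)
    (E : PhragmenExec A D k) (S : Finset V) (hS : S.Nonempty)
    (ℓ : ℕ) (hℓ : 0 < ℓ) (hcoh : Cohesive A D k ℓ S) :
    ℓ ≤ ((((univ.filter (fun j : Fin E.num => E.time j ≤ (ℓ : ℝ) / (S.card : ℝ))).image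
        E.item)) ∩ S.biUnion (fun i => posOf (A i) ∪ negOf (D i))).card := by
  set t : ℝ := (ℓ : ℝ) / (S.card : ℝ) with ht
  set U := S.biUnion (fun i => posOf (A i) ∪ negOf (D i)) with hUdef
  have hU : ∀ x, x ∈ U ↔ ∃ i ∈ S, i ∈ supporters A D x := fun x => by
    simp only [hUdef, mem_biUnion, mem_ballot_iff_mem_supporters]
  have hs : (0 : ℝ) < S.card := by exact_mod_cast hS.card_pos
  have ht0 : 0 ≤ t := by positivity
  have hst : S.card * t = ℓ := by rw [ht]; field_simp
  obtain ⟨N, hN, htime⟩ := E.exists_purchase_count t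
  have hW : (univ.filter (fun j : Fin E.num => E.time j ≤ t)).image E.item = E.bought N := by
    simp only [htime, PhragmenExec.bought]
  rw [hW]
  by_contra! hlt
  have hrest : 1 ≤ ∑ i ∈ S, (t - E.spent N i) := by
    have h := E.sum_spent_le_card N S U hU
    have h' : ((E.bought N ∩ U).card : ℝ) + 1 ≤ ℓ := by exact_mod_cast hlt
    rw [sum_sub_distrib, sum_const, nsmul_eq_mul]
    linarith
  have hTcard : ((E.bought N \ U).card : ℝ) + ℓ ≤ Fintype.card V * t := by
    have h1 := E.card_le_sum_spent_compl N S U hU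
    have h2 : ∑ i ∈ Sᶜ, E.spent N i ≤ ∑ i ∈ Sᶜ, t :=
      sum_le_sum fun i _ => E.spent_le ht0 i hN fun j => (htime j).2
    have h3 : (S.card : ℝ) + Sᶜ.card = Fintype.card V := by
      exact_mod_cast card_add_card_compl S
    rw [sum_const, nsmul_eq_mul] at h2
    rw [← h3]
    linarith
  rcases hcoh (E.bought N \ U) ((E.feasible_bought hN).mono sdiff_subset) with
    ⟨X, hX, hXcard, hfeas⟩ | hlt'
  · have hXS : ∀ x ∈ X, S ⊆ supporters A D x := fun x hx =>
      subset_supporters_of_mem_common (hX hx)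
    obtain ⟨i, hi⟩ := hS
    have hXU : X ⊆ U := fun x hx => (hU x).2 ⟨i, hi, hXS x hx hi⟩
    obtain ⟨x, hxX, hx⟩ := exists_extension_of_card_lt (Y := E.bought N ∩ U) hfeas
      (disjoint_of_subset_right hXU sdiff_disjoint) (fun x hx hx' => by
        obtain ⟨i', hi', hsup⟩ := (hU _).1 (mem_inter.1 hx').2
        exact notMem_supporters_swap hdisj (hXS x hx hi') hsup) (hlt.trans_le hXcard)
    rw [sdiff_union_inter] at hx
    exact E.not_availAt_of_one_le hN htime ⟨i, hi⟩ hrest (hXS x hxX) ((E.availAt_iff N x).2 hx)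
  · have hn : 0 < Fintype.card V := hS.card_pos.trans_le (card_le_univ S)
    have hℓ' : (0 : ℚ) < ℓ := by exact_mod_cast hℓ
    rw [div_lt_div_iff₀ (by positivity) (by exact_mod_cast hn)] at hlt'
    have h : (ℓ : ℝ) * Fintype.card V < S.card * ((E.bought N \ U).card + ℓ) := by
      exact_mod_cast hlt'
    have h' := mul_le_mul_of_nonneg_left hTcard hs.le
    rw [mul_left_comm, hst] at h'
    linarith
end

section
/- Let k', d, a, w, r, b, p be nonnegative integers satisfying: b ≤ r, r + a ≤ w, p ≤ w − r − a, w − r − a ≤ k', a ≤ d, r − b ≤ d − a, d − a ≤ k', and w ≥ 1. Then (r−b)·(w−r−a)·(1/w + 1/(w−1)) + ((d−a)−(r−b))·(w−r−a)·(1/w) + (r−b)·(k'−(w−r−a))·(1/w) + k'·(a+b)·(1/w) + (k'−(d−a))·p·(1/w) ≤ k' + (r−b)/w ≤ k' + 1, where when w = 1 the term with denominator w−1 is vacuous since its coefficient (r−b)·(w−r−a) is then necessarily 0. (This per-voter inequality, summed over voters outside a cohesive group, yields that the aggregate PAV-score loss Δ of the remaining voters under the exchange construction satisfies Δ ≥ −(k'+1)·(n−|S|).)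 -/
/-- If `m ≤ w - 1` whenever `x` is nonzero, then `x * m / (w - 1) ≤ x * (m + 1) / w`. -/
theorem mul_mul_one_div_sub_one_le {x m w : ℝ} (hx : 0 ≤ x) (hm : 0 ≤ m) (hw : 1 ≤ w)
    (hmw : x ≠ 0 → m ≤ w - 1) :
    x * m * (1 / (w - 1)) ≤ x * (m + 1) * (1 / w) := by
  rcases eq_or_ne x 0 with rfl | hx0
  · simp
  have hm1 := hmw hx0
  rcases hw.eq_or_lt with rfl | hw1
  · simp only [sub_self, div_zero, mul_zero]
    positivity
  have hw0 : 0 < w - 1 := sub_pos.2 hw1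
  rw [mul_one_div, mul_one_div, div_le_div_iff₀ hw0 (by linarith)]
  nlinarith [mul_nonneg hx (sub_nonneg.2 hm1)]


/-- the arithmetic core of the bound `Δ ≥ -(k'+1)(n-|S|)` on the
PAV-score loss of voters outside the cohesive group: for nonnegative integers
`k', d, a, w, r, b, p` satisfying the listed constraints, the per-voter loss is
at most `k' + (r-b)/w ≤ k' + 1`.  (When `w = 1` the term with denominator
`w - 1` has coefficient `(r-b)·(w-r-a) = 0`, and division by zero is the Lean
convention `x/0 = 0`, so the statement is well formed.) -/
theorem stmt_6 (k' d a w r b p : ℕ)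
    (h1 : b ≤ r) (h2 : r + a ≤ w)
    (h3 : (p : ℝ) ≤ (w : ℝ) - (r : ℝ) - (a : ℝ))
    (h4 : (w : ℝ) - (r : ℝ) - (a : ℝ) ≤ (k' : ℝ))
    (h5 : a ≤ d)
    (h6 : (r : ℝ) - (b : ℝ) ≤ (d : ℝ) - (a : ℝ))
    (h7 : (d : ℝ) - (a : ℝ) ≤ (k' : ℝ))
    (h8 : 1 ≤ w) :
    ((r : ℝ) - b) * ((w : ℝ) - r - a) * (1 / (w : ℝ) + 1 / ((w : ℝ) - 1)) +
        (((d : ℝ) - a) - ((r : ℝ) - b)) * ((w : ℝ) - r - a) * (1 / (w : ℝ)) +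
        ((r : ℝ) - b) * ((k' : ℝ) - ((w : ℝ) - r - a)) * (1 / (w : ℝ)) +
        (k' : ℝ) * ((a : ℝ) + b) * (1 / (w : ℝ)) +
        ((k' : ℝ) - ((d : ℝ) - a)) * (p : ℝ) * (1 / (w : ℝ)) ≤
      (k' : ℝ) + ((r : ℝ) - b) / (w : ℝ) ∧
    (k' : ℝ) + ((r : ℝ) - b) / (w : ℝ) ≤ (k' : ℝ) + 1 := by
  have hb : (b : ℝ) ≤ r := by exact_mod_cast h1
  have hra : (r : ℝ) + a ≤ w := by exact_mod_cast h2
  have hw : (1 : ℝ) ≤ w := by exact_mod_cast h8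
  have hw0 : (0 : ℝ) < w := by linarith
  have ha : (0 : ℝ) ≤ a := a.cast_nonneg
  have hb0 : (0 : ℝ) ≤ b := b.cast_nonneg
  constructor
  · have key := mul_mul_one_div_sub_one_le (x := (r : ℝ) - b) (m := (w : ℝ) - r - a)
      (by linarith) (by linarith) hw fun hne => by
        have hr : 1 ≤ r := by
          by_contra! h
          obtain rfl : r = 0 := by omega
          obtain rfl : b = 0 := by omega
          simp at hne
        have hr' : (1 : ℝ) ≤ r := by exact_mod_cast hr
        linarith
    have hp : ((k' : ℝ) - (d - a)) * p * (1 / (w : ℝ)) ≤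
        ((k' : ℝ) - (d - a)) * (w - r - a) * (1 / (w : ℝ)) := by
      have := sub_nonneg.2 h7
      gcongr
    have hk : (k' : ℝ) = k' * w * (1 / (w : ℝ)) := by field_simp
    rw [div_eq_mul_one_div]
    linear_combination key + hp - hk
  · have : ((r : ℝ) - b) / w ≤ 1 := (div_le_one hw0).2 (by linarith)
    linarith
end

section
/- Every priceable outcome with opposition-taxed prices and per-voter budget at most k/n provides Group Veto. Precisely: let E=(C,V,k,B) be an election, W ⊆ C a committee, p : W → ℝ a price function with |A_c| > |D_c| and p(c) ≥ |A_c|/(|A_c| − |D_c|) for every c ∈ W, and suppose there are payment functions π_i : W → ℝ≥0 (i ∈ V) such that π_i(c) = 0 whenever c ∉ A_i, ∑_{i∈V} π_i(c) ≥ p(c) for every c ∈ W, and ∑_{c∈W} π_i(c) ≤ k/n for every i ∈ V. Then for every positive integer ℓ ≤ k, every T ⊆ C with |T| ≥ ℓ, and every S ⊆ V that is (ℓ,T)-negatively-cohesive, it holds |W ∩ T| ≤ ℓ. -/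
open Finset

variable {C V : Type*}

/-- `A_c`: the set of voters approving candidate `c`. -/
def apprs [Fintype V] (A : V → Finset C) (c : C) [DecidableEq C] : Finset V :=
  univ.filter (fun i => c ∈ A i)

/-- `D_c`: the set of voters disapproving candidate `c`. -/
def disapprs [Fintype V] (D : V → Finset C) (c : C) [DecidableEq C] : Finset V :=
  univ.filter (fun i => c ∈ D i)

/-- The opposition-taxed price `p(c) = |A_c| / (|A_c| - |D_c|)`. -/
noncomputable def price [Fintype V] [DecidableEq C] (A D : V → Finset C) (c : C) : ℝ :=
  ((apprs A c).card : ℝ) / (((apprs A c).card : ℝ) - ((disapprs D c).card : ℝ))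

/-- `S` is `ℓ`-positively-cohesive: some `T ⊆ A_S` with `|T| ≥ ℓ` such that
`|S| - |D_c| ≥ ℓ·n/k` for every `c ∈ T`. -/
def PosCohesive [Fintype C] [DecidableEq C] [Fintype V] (A D : V → Finset C)
    (k ℓ : ℕ) (S : Finset V) : Prop :=
  ∃ T ⊆ comInt A S, ℓ ≤ T.card ∧ ∀ c ∈ T,
    (ℓ : ℝ) * (Fintype.card V : ℝ) / (k : ℝ) ≤ (S.card : ℝ) - ((disapprs D c).card : ℝ)

/-- `ap(T)`: the set of voters approving at least one candidate of `T`. -/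
def ap [Fintype V] [DecidableEq C] (A : V → Finset C) (T : Finset C) : Finset V :=
  univ.filter (fun i => (A i ∩ T).Nonempty)

/-- For `0 ≤ d < x`, the quotient `x / (x - d)` is antitone in `x` and monotone in `d`. -/
lemma div_sub_le_div_sub {a s x d : ℝ} (hs : 0 ≤ s) (hsd : s ≤ d) (hdx : d < x) (hxa : x ≤ a) :
    a / (a - s) ≤ x / (x - d) := by
  rw [div_le_div_iff₀ (by linarith) (by linarith)]
  nlinarith [mul_le_mul hsd hxa (by linarith) (by linarith)]

/-- Only voters in `ap A T` pay for candidates of `T`, so their budgets bound the payments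
for `W ∩ T`. -/
lemma sum_payments_le [DecidableEq C] [Fintype V] {A : V → Finset C} {W : Finset C}
    {π : V → C → ℝ} {b : ℝ} (hπ0 : ∀ i c, 0 ≤ π i c)
    (hπA : ∀ (i : V) (c : C), c ∉ A i → π i c = 0)
    (hbudget : ∀ i : V, ∑ c ∈ W, π i c ≤ b) (T : Finset C) :
    ∑ c ∈ W ∩ T, ∑ i : V, π i c ≤ ((ap A T).card : ℝ) * b := by
  rw [sum_comm, ← sum_subset (subset_univ (ap A T)), ← nsmul_eq_mul]
  · exact sum_le_card_nsmul _ _ _ fun i _ =>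
      (sum_le_sum_of_subset_of_nonneg inter_subset_left fun c _ _ => hπ0 i c).trans (hbudget i)
  · intro i _ hi
    refine sum_eq_zero fun c hc => hπA i c fun hcA => hi ?_
    exact mem_filter.2 ⟨mem_univ i, c, mem_inter.2 ⟨hcA, (mem_inter.1 hc).2⟩⟩

/-- every priceable outcome with opposition-taxed prices and
per-voter budget at most `k/n` provides Group Veto: if `W` is supported by
payments `π_i` with `π_i(c) = 0` for `c ∉ A_i`, covering a price
`p(c) ≥ |A_c|/(|A_c|-|D_c|)` for each `c ∈ W`, where each voter spends at most
`k/n`, then `|W ∩ T| ≤ ℓ` for every `(ℓ,T)`-negatively-cohesive group `S`. -/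
theorem stmt_9 [Fintype C] [DecidableEq C] [Fintype V] [DecidableEq V]
    (k : ℕ) (A D : V → Finset C)
    (hdisj : ∀ i, Disjoint (A i) (D i)) (hk : 0 < k) (hkm : k ≤ Fintype.card C)
    (W : Finset C) (p : C → ℝ) (π : V → C → ℝ)
    (hpW : ∀ c ∈ W, (disapprs D c).card < (apprs A c).card ∧
      ((apprs A c).card : ℝ) / (((apprs A c).card : ℝ) - ((disapprs D c).card : ℝ)) ≤ p c)
    (hπ0 : ∀ i c, 0 ≤ π i c)
    (hπA : ∀ (i : V) (c : C), c ∉ A i → π i c = 0)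
    (hcover : ∀ c ∈ W, p c ≤ ∑ i : V, π i c)
    (hbudget : ∀ i : V, ∑ c ∈ W, π i c ≤ (k : ℝ) / (Fintype.card V : ℝ))
    (ℓ : ℕ) (hℓ : 0 < ℓ) (hℓk : ℓ ≤ k)
    (T : Finset C) (hT : ℓ ≤ T.card) (S : Finset V)
    (hTD : ∀ i ∈ S, T ⊆ D i)
    (hsize : ((ap A T).card : ℝ) - (ℓ : ℝ) * (Fintype.card V : ℝ) / (k : ℝ) ≤ (S.card : ℝ)) :
    (W ∩ T).card ≤ ℓ := by
  obtain hE | ⟨c₀, hc₀⟩ := (W ∩ T).eq_empty_or_nonempty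
  · simp [hE]
  have hA : ∀ c ∈ W ∩ T, (apprs A c).card ≤ (ap A T).card := fun c hc =>
    card_le_card fun i hi => mem_filter.2
      ⟨mem_univ i, c, mem_inter.2 ⟨(mem_filter.1 hi).2, (mem_inter.1 hc).2⟩⟩
  have hS : ∀ c ∈ W ∩ T, S.card ≤ (disapprs D c).card := fun c hc =>
    card_le_card fun i hi => mem_filter.2 ⟨mem_univ i, hTD i hi (mem_inter.1 hc).2⟩
  have hSap : (S.card : ℝ) < (ap A T).card := by
    exact_mod_cast (hS c₀ hc₀).trans_lt
      ((hpW c₀ (mem_inter.1 hc₀).1).1.trans_le (hA c₀ hc₀))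
  have hS0 : (0 : ℝ) ≤ S.card := Nat.cast_nonneg _
  have hap : (0 : ℝ) < (ap A T).card := hS0.trans_lt hSap
  have hn : (0 : ℝ) < Fintype.card V :=
    hap.trans_le (Nat.cast_le.2 (card_le_univ _))
  have hk' : (0 : ℝ) < k := Nat.cast_pos.2 hk
  have hgap : (0 : ℝ) < (ap A T).card - S.card := sub_pos.2 hSap
  have hprice : ∀ c ∈ W ∩ T,
      ((ap A T).card : ℝ) / ((ap A T).card - S.card) ≤ ∑ i : V, π i c := by
    intro c hc
    have hcW := (mem_inter.1 hc).1
    exact (div_sub_le_div_sub hS0 (Nat.cast_le.2 (hS c hc)) (Nat.cast_lt.2 (hpW c hcW).1)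
      (Nat.cast_le.2 (hA c hc))).trans ((hpW c hcW).2.trans (hcover c hcW))
  have hpaid := (card_nsmul_le_sum _ _ _ hprice).trans (sum_payments_le hπ0 hπA hbudget T)
  rw [nsmul_eq_mul, mul_div_assoc', div_le_iff₀ hgap, mul_comm, mul_assoc,
    mul_le_mul_iff_right₀ hap] at hpaid
  have hfinal : ((W ∩ T).card : ℝ) ≤ ℓ := calc
    ((W ∩ T).card : ℝ) ≤ (k : ℝ) / Fintype.card V * ((ap A T).card - S.card) := hpaid
    _ ≤ (k : ℝ) / Fintype.card V * (ℓ * Fintype.card V / k) := by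
      gcongr
      linarith
    _ = ℓ := by field_simp
  exact_mod_cast hfinal
end

section
/- No generalized Thiele rule other than PAV satisfies EJPR. Precisely: let f : ℕ × ℕ → ℝ satisfy f(z,0) = H(z) for all z, f(z,s) ≤ f(z,0) for all z,s, and f(z₀,s₀) < f(z₀,0) for some z₀,s₀. Then there exists an election E=(C,V,k,B) such that every committee W ⊆ C with |W| ≤ k maximizing ∑_{i∈V} f(|W ∩ A_i|, |W ∩ D_i|) over all committees of size at most k fails to provide EJPR. -/
open Finset

variable {C V : Type*}

/-- The harmonic number `H(x) = ∑_{j=1}^x 1/j`, as a real number. -/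
noncomputable def harmR (x : ℕ) : ℝ := ∑ j ∈ Finset.range x, 1 / ((j : ℝ) + 1)

theorem harmR_succ (x : ℕ) : harmR (x + 1) = harmR x + 1 / ((x : ℝ) + 1) := by
  simp [harmR, Finset.sum_range_succ]

theorem harmR_mono : Monotone harmR :=
  monotone_nat_of_le_succ fun x => by
    rw [harmR_succ]
    have : (0 : ℝ) ≤ 1 / ((x : ℝ) + 1) := by positivity
    linarith

/-- With as many seats as voters, an EJPR committee contains the common approval set `T` of every
group of identical voters whose size exceeds the opposition to each member of `T` by `|T|`. -/
theorem subset_of_ejpr [Fintype C] [DecidableEq C] [Fintype V] {A D : V → Finset C} {k : ℕ}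
    {W T : Finset C} {S : Finset V} (hV : Fintype.card V = k) (hTk : T.card ≤ k)
    (hA : ∀ i ∈ S, A i = T) (hD : ∀ c ∈ T, T.card + (disapprs D c).card ≤ S.card)
    (hW : ∀ ℓ : ℕ, 0 < ℓ → ℓ ≤ k → ∀ S : Finset V,
      PosCohesive A D k ℓ S → ∃ i ∈ S, ℓ ≤ (A i ∩ W).card) : T ⊆ W := by
  rcases T.eq_empty_or_nonempty with rfl | hT
  · simp
  have hpos : 0 < T.card := hT.card_pos
  have hk : (k : ℝ) ≠ 0 := by exact_mod_cast (by omega : k ≠ 0)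
  obtain ⟨i, hi, hcard⟩ := hW T.card hpos hTk S ⟨T, fun c hc => by
    simpa [comInt] using fun i hi => hA i hi ▸ hc, le_rfl, fun c hc => by
    rw [hV, mul_div_cancel_right₀ _ hk]
    have h : ((T.card + (disapprs D c).card : ℕ) : ℝ) ≤ S.card := by exact_mod_cast hD c hc
    push_cast at h
    linarith⟩
  rw [hA i hi] at hcard
  exact inter_eq_left.mp (eq_of_subset_of_card_le inter_subset_left hcard)

/-- `Fin (a + b + c)` splits into three classes of prescribed sizes. -/
theorem exists_three_classes (a b c : ℕ) : ∃ T Z P : Finset (Fin (a + b + c)),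
    T.card = a ∧ Z.card = b ∧ P.card = c ∧
      Disjoint T Z ∧ Disjoint T P ∧ Disjoint Z P := by
  obtain ⟨X, -, hX⟩ := exists_subset_card_eq (s := (univ : Finset (Fin (a + b + c))))
    (n := a + b) (by simp)
  obtain ⟨T, hTX, hT⟩ := exists_subset_card_eq (s := X) (n := a) (by omega)
  refine ⟨T, X \ T, Xᶜ, hT, ?_, ?_, disjoint_sdiff, ?_, ?_⟩
  · rw [card_sdiff_of_subset hTX]; omega
  · rw [card_compl, Fintype.card_fin]; omega
  · exact disjoint_compl_right.mono_left hTX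
  · exact disjoint_compl_right.mono_left sdiff_subset

/-- no generalized Thiele rule other than PAV satisfies EJPR:
if `f(z,0) = H(z)` for all `z`, `f(z,s) ≤ f(z,0)` for all `z,s`, and
`f(z₀,s₀) < f(z₀,0)` for some `z₀,s₀`, then there is an election such that every
committee of size at most `k` maximizing `∑_i f(|W ∩ A_i|, |W ∩ D_i|)` fails to
provide EJPR. -/
theorem stmt_10 (f : ℕ → ℕ → ℝ)
    (hf0 : ∀ z, f z 0 = harmR z)
    (hfle : ∀ z s, f z s ≤ f z 0)
    (z₀ s₀ : ℕ) (hlt : f z₀ s₀ < f z₀ 0) :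
    ∃ (m n k : ℕ) (A D : Fin n → Finset (Fin m)),
      (∀ i, Disjoint (A i) (D i)) ∧ 0 < k ∧ k ≤ m ∧ 0 < n ∧
      ∀ W : Finset (Fin m), W.card ≤ k →
        (∀ W' : Finset (Fin m), W'.card ≤ k →
          ∑ i : Fin n, f ((W' ∩ A i).card) ((W' ∩ D i).card) ≤
            ∑ i : Fin n, f ((W ∩ A i).card) ((W ∩ D i).card)) →
        ¬ (∀ ℓ : ℕ, 0 < ℓ → ℓ ≤ k → ∀ S : Finset (Fin n),
            PosCohesive A D k ℓ S → ∃ i ∈ S, ℓ ≤ (A i ∩ W).card) := by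
  classical
  obtain ⟨s, hs, hs'⟩ : ∃ s, f z₀ (s + 1) < f z₀ 0 ∧ f z₀ s = f z₀ 0 := by
    have hex : ∃ s, f z₀ s < f z₀ 0 := ⟨s₀, hlt⟩
    have hmin := fun m => Nat.find_min hex (m := m)
    have hspec := Nat.find_spec hex
    cases hfind : Nat.find hex with
    | zero => rw [hfind] at hspec; exact absurd hspec (lt_irrefl _)
    | succ s =>
      rw [hfind] at hspec
      exact ⟨s, hspec, (hfle z₀ s).antisymm (not_lt.mp (hmin s (by omega)))⟩
  obtain ⟨b, hb⟩ := exists_nat_gt (4 / (f z₀ 0 - f z₀ (s + 1)))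
  have hδ : 0 < f z₀ 0 - f z₀ (s + 1) := sub_pos.mpr hs
  -- Voters approving `T`, `Z`, `P` are due `N + 1`, `z₀` and the rest of the `2N + 2 + z₀` seats.
  obtain ⟨ρ, N, hN, hsN, hbN⟩ : ∃ ρ N : ℕ, N + 1 = ρ + z₀ + 2 ∧ s ≤ N ∧ b ≤ N :=
    ⟨b + s, b + s + z₀ + 1, by omega, by omega, by omega⟩
  obtain ⟨T, Z, P, hT, hZ, hP, hTZ, hTP, hZP⟩ := exists_three_classes (N + 1) z₀ (N + 2)
  obtain ⟨T₀, hT₀, hT₀card⟩ := exists_subset_card_eq (s := T) (n := s + 1) (by omega)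
  obtain ⟨t, ht⟩ : T₀.Nonempty := card_pos.mp (by omega)
  have htT : t ∈ T := hT₀ ht
  have htZ : t ∉ Z := disjoint_left.mp hTZ htT
  have htP : t ∉ P := disjoint_left.mp hTP htT
  let A : Fin ((N + 1 + (z₀ + 1)) + (z₀ + 1) + ρ) → Finset (Fin (N + 1 + z₀ + (N + 2))) :=
    Fin.append (Fin.append (fun _ => T) (fun _ => Z)) (fun _ => P)
  let D : Fin ((N + 1 + (z₀ + 1)) + (z₀ + 1) + ρ) → Finset (Fin (N + 1 + z₀ + (N + 2))) :=
    Fin.append (Fin.append (fun _ => ∅) (fun _ => T₀)) (fun _ => ∅)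
  have hscore : ∀ W : Finset (Fin (N + 1 + z₀ + (N + 2))),
      ∑ i, f ((W ∩ A i).card) ((W ∩ D i).card) =
        ((N : ℝ) + 1 + (z₀ + 1)) * f (W ∩ T).card 0 +
          ((z₀ : ℝ) + 1) * f (W ∩ Z).card (W ∩ T₀).card + (ρ : ℝ) * f (W ∩ P).card 0 := by
    intro W
    simp [Fin.sum_univ_add, A, D]
  let G : Finset (Fin ((N + 1 + (z₀ + 1)) + (z₀ + 1) + ρ)) :=
    univ.map ((Fin.castAddEmb (z₀ + 1)).trans (Fin.castAddEmb ρ))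
  let O : Finset (Fin ((N + 1 + (z₀ + 1)) + (z₀ + 1) + ρ)) :=
    univ.map ((Fin.natAddEmb (N + 1 + (z₀ + 1))).trans (Fin.castAddEmb ρ))
  have hG : G.card = N + 1 + (z₀ + 1) := by simp [G]
  have hO : O.card = z₀ + 1 := by simp [O]
  have hDis : ∀ c, disapprs D c ⊆ O := by
    intro c i hi
    replace hi : c ∈ D i := by simpa [disapprs] using hi
    induction i using Fin.addCases with
    | left i =>
      induction i using Fin.addCases with
      | left i => simp [D] at hi
      | right i => simp [O]
    | right i => simp [D] at hi
  have hDisZ : ∀ c ∈ Z, disapprs D c = ∅ := by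
    intro c hc
    have hcT : c ∉ T₀ := fun h => disjoint_left.mp hTZ (hT₀ h) hc
    refine filter_eq_empty_iff.mpr fun i _ => ?_
    induction i using Fin.addCases with
    | left i => induction i using Fin.addCases <;> simp [D, hcT]
    | right i => simp [D]
  refine ⟨N + 1 + z₀ + (N + 2), (N + 1 + (z₀ + 1)) + (z₀ + 1) + ρ, N + 1 + z₀ + (N + 1), A, D,
    ?_, by omega, by omega, by omega, ?_⟩
  · intro i
    induction i using Fin.addCases with
    | left i =>
      induction i using Fin.addCases with
      | left i => simp [A, D]
      | right i => simpa [A, D] using (hTZ.mono_left hT₀).symm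
    | right i => simp [A, D]
  intro W hWk hopt hW
  have hcardV : Fintype.card (Fin ((N + 1 + (z₀ + 1)) + (z₀ + 1) + ρ)) = N + 1 + z₀ + (N + 1) := by
    rw [Fintype.card_fin]; omega
  have hTW : T ⊆ W := by
    refine subset_of_ejpr (S := G) hcardV (by omega) (by simp [G, A]) (fun c _ => ?_) hW
    have := card_le_card (hDis c)
    omega
  have hZW : Z ⊆ W := by
    refine subset_of_ejpr (S := O) hcardV (by omega) (by simp [O, A]) (fun c hc => ?_) hW
    simp [hDisZ c hc, hZ, hO]
  have hPW : (W ∩ P).card ≤ N + 1 := by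
    have hsub : T ∪ Z ∪ (W ∩ P) ⊆ W := union_subset (union_subset hTW hZW) inter_subset_left
    have hle := card_le_card hsub
    have hdisj : Disjoint (T ∪ Z) (W ∩ P) :=
      (disjoint_union_left.mpr ⟨hTP, hZP⟩).mono_right inter_subset_right
    rw [card_union_of_disjoint hdisj, card_union_of_disjoint hTZ] at hle
    omega
  have hbetter := hopt (univ.erase t) (by
    rw [card_erase_of_mem (mem_univ t), card_univ, Fintype.card_fin]; omega)
  rw [hscore, hscore] at hbetter
  simp only [erase_inter, univ_inter] at hbetter
  rw [inter_eq_right.mpr hTW, inter_eq_right.mpr hZW, inter_eq_right.mpr (hT₀.trans hTW),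
    card_erase_of_mem htT, card_erase_of_mem ht, erase_eq_of_notMem htZ, erase_eq_of_notMem htP,
    hT, hZ, hP, hT₀card, Nat.add_sub_cancel, Nat.add_sub_cancel, hs', hf0 N, hf0 (N + 1),
    hf0 (N + 2), hf0 (W ∩ P).card] at hbetter
  have hmono : (ρ : ℝ) * harmR (W ∩ P).card ≤ ρ * harmR (N + 1) :=
    mul_le_mul_of_nonneg_left (harmR_mono hPW) (Nat.cast_nonneg ρ)
  have hstep : harmR (N + 2) = harmR (N + 1) + 1 / ((N : ℝ) + 2) := by
    rw [harmR_succ (N + 1)]; push_cast; ring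
  rw [hstep, harmR_succ N] at hbetter
  rw [harmR_succ N] at hmono
  have hNρ : (N : ℝ) + 1 = ρ + z₀ + 2 := by exact_mod_cast hN
  have hbN' : (b : ℝ) ≤ N := by exact_mod_cast hbN
  have hgap : 4 < (f z₀ 0 - f z₀ (s + 1)) * (N + 1) := by
    rw [div_lt_iff₀ hδ] at hb
    nlinarith
  have hz : (0 : ℝ) ≤ z₀ := Nat.cast_nonneg z₀
  have hNpos : (0 : ℝ) < (N : ℝ) + 1 := by positivity
  have hgain : (z₀ + 1) * (4 / ((N : ℝ) + 1)) < (z₀ + 1) * (f z₀ 0 - f z₀ (s + 1)) :=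
    mul_lt_mul_of_pos_left ((div_lt_iff₀ hNpos).mpr hgap) (by positivity)
  have hloss : ((N : ℝ) + 1 + (z₀ + 1)) * (1 / (N + 1)) - ρ * (1 / (N + 2)) ≤
      (z₀ + 1) * (4 / ((N : ℝ) + 1)) := by
    have hρ : (ρ : ℝ) = N + 2 - (z₀ + 3) := by linarith
    have h₁ : ((N : ℝ) + 1 + (z₀ + 1)) * (1 / (N + 1)) = 1 + (z₀ + 1) * (1 / (N + 1)) := by
      field_simp
    have h₂ : (ρ : ℝ) * (1 / (N + 2)) = 1 - (z₀ + 3) * (1 / (N + 2)) := by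
      rw [hρ]; field_simp
    have h₃ : 1 / ((N : ℝ) + 2) ≤ 1 / (N + 1) := one_div_le_one_div_of_le hNpos (by linarith)
    have h₄ : (0 : ℝ) ≤ 1 / (N + 1) := by positivity
    rw [h₁, h₂, show (4 : ℝ) / (N + 1) = 4 * (1 / (N + 1)) by ring]
    nlinarith [mul_le_mul_of_nonneg_left h₃ (by linarith : (0 : ℝ) ≤ z₀ + 3), mul_nonneg hz h₄]
  linarith
end

section
/- The feasibility constraints of the symmetric model do not form a matroid. Precisely: let C = {a, b, c} consist of three distinct candidates, let k = 2, and let F = {W ⊆ C ∪ ¬C : |W ∩ C| ≤ k and for no x ∈ C both x ∈ W and ¬x ∈ W}. Then B₁ = {a, b, ¬c} ∈ F and B₂ = {c, a} ∈ F with |B₂| < |B₁|, yet there is no element x ∈ B₁ ∖ B₂ such that B₂ ∪ {x} ∈ F; hence F violates the matroid augmentation (exchange) axiom. -/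
open Finset

/-- Feasibility of an outcome `W ⊆ C ∪ ¬C` (positive candidates encoded as
`Sum.inl`, negative counterparts as `Sum.inr`) for candidate set `Cs` and
committee-size bound `k`. -/
def Feas15 {α : Type*} [DecidableEq α] (Cs : Finset α) (k : ℕ)
    (W : Finset (α ⊕ α)) : Prop :=
  W ⊆ Cs.image Sum.inl ∪ Cs.image Sum.inr ∧
  (W.filter (fun x => x.isLeft = true)).card ≤ k ∧
  ∀ x ∈ Cs, ¬ (Sum.inl x ∈ W ∧ Sum.inr x ∈ W)

/-- the feasibility constraints of the symmetric model do not form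
a matroid: with `C = {a, b, c}` and `k = 2`, the feasible sets
`B₁ = {a, b, ¬c}` and `B₂ = {c, a}` satisfy `|B₂| < |B₁|`, yet no
`x ∈ B₁ ∖ B₂` can be added to `B₂` while preserving feasibility — the matroid
augmentation axiom fails. -/
theorem stmt_15 {α : Type*} [DecidableEq α] (a b c : α)
    (hab : a ≠ b) (hac : a ≠ c) (hbc : b ≠ c) :
    Feas15 ({a, b, c} : Finset α) 2
        ({Sum.inl a, Sum.inl b, Sum.inr c} : Finset (α ⊕ α)) ∧
    Feas15 ({a, b, c} : Finset α) 2 ({Sum.inl c, Sum.inl a} : Finset (α ⊕ α)) ∧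
    ({Sum.inl c, Sum.inl a} : Finset (α ⊕ α)).card <
      ({Sum.inl a, Sum.inl b, Sum.inr c} : Finset (α ⊕ α)).card ∧
    ¬ ∃ x ∈ ({Sum.inl a, Sum.inl b, Sum.inr c} : Finset (α ⊕ α)) \
        ({Sum.inl c, Sum.inl a} : Finset (α ⊕ α)),
      Feas15 ({a, b, c} : Finset α) 2
        (insert x ({Sum.inl c, Sum.inl a} : Finset (α ⊕ α))) := by
  refine ⟨⟨?_, ?_, ?_⟩, ⟨?_, ?_, ?_⟩, ?_, ?_⟩
  · intro x; simp; grind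
  · simp [filter_insert, filter_singleton, card_le_two]
  · simp [hac, hbc, hac.symm, hbc.symm]
  · intro x; simp; grind
  · simp [filter_insert, filter_singleton, card_le_two]
  · simp
  · simp [card_insert_of_notMem, hab, hac.symm]
  · rintro ⟨x, hx, -, hcard, hneg⟩
    simp only [mem_sdiff, mem_insert, mem_singleton] at hx
    obtain ⟨rfl | rfl | rfl, hx⟩ := hx
    · simp at hx
    · simp [filter_insert, filter_singleton, card_insert_of_notMem, hab.symm, hbc,
        hac.symm] at hcard
    · simpa using hneg c
end
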